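/- Let n_x ≥ 1, F1 ∈ ℂ^{n_x×n_x}, F2 ∈ ℂ^{n_x×n_x²}, and let u : ℝ → ℂ^{n_x} be differentiable and satisfy u′(t) = F1·u(t) + F2·(u(t) ⊗ u(t)) for all t. Then for every integer j ≥ 1 and all t, the j-fold Kronecker power u(t)^{⊗j} : ℝ → ℂ^{n_x^j} is differentiable and d/dt [u(t)^{⊗j}] = (Σ_{l=0}^{j−1} I_{n_x}^{⊗l} ⊗ F1 ⊗ I_{n_x}^{⊗(j−l−1)}) · u(t)^{⊗j} + (Σ_{l=0}^{j−1} I_{n_x}^{⊗l} ⊗ F2 ⊗ I_{n_x}^{⊗(j−l−1)}) · u(t)^{⊗(j+1)}. -/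

import Mathlib

noncomputable section
open Matrix BigOperators Finset

/-- Kronecker product of complex matrices, with the big-endian index identification
`i = p·i₁ + i₂` (first factor is the high-order register). -/
def kron {m n p q : ℕ} (A : Matrix (Fin m) (Fin n) ℂ) (B : Matrix (Fin p) (Fin q) ℂ) :
    Matrix (Fin (m * p)) (Fin (n * q)) ℂ :=
  Matrix.of fun i j => A i.divNat j.divNat * B i.modNat j.modNat

/-- `l`-fold Kronecker power `B^{⊗l}`. -/
def kronPow {n : ℕ} (B : Matrix (Fin n) (Fin n) ℂ) : (l : ℕ) → Matrix (Fin (n ^ l)) (Fin (n ^ l)) ℂ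
  | 0 => 1
  | l + 1 => kron (kronPow B l) B

/-- Recast a matrix along equalities of its dimensions. -/
def mcast {a b c d : ℕ} (h1 : a = b) (h2 : c = d) (M : Matrix (Fin a) (Fin c) ℂ) :
    Matrix (Fin b) (Fin d) ℂ :=
  M.submatrix (Fin.cast h1.symm) (Fin.cast h2.symm)

theorem size1 {a j l : ℕ} (h : l < j) : a ^ l * (a * a ^ (j - l - 1)) = a ^ j := by
  rw [← pow_succ', ← pow_add]; congr 1; omega

theorem size2 {a j l : ℕ} (h : l < j) : a ^ l * (a ^ 2 * a ^ (j - l - 1)) = a ^ (j + 1) := by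
  rw [← pow_add, ← pow_add]; congr 1; omega

/-- The `b × d` matrix whose entries in the first `a` rows and first `c` columns are
those of `M` and whose other entries are 0. -/
def pad2 {a c : ℕ} (b d : ℕ) (M : Matrix (Fin a) (Fin c) ℂ) : Matrix (Fin b) (Fin d) ℂ :=
  Matrix.of fun i j => if h : (i : ℕ) < a ∧ (j : ℕ) < c then M ⟨i, h.1⟩ ⟨j, h.2⟩ else 0

/-- A_j^j = Σ_{l=0}^{j−1} I_{n_x}^{⊗l} ⊗ F1 ⊗ I_{n_x}^{⊗(j−l−1)}. -/
def Ajj (nx : ℕ) (F1 : Matrix (Fin nx) (Fin nx) ℂ) (j : ℕ) :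
    Matrix (Fin (nx ^ j)) (Fin (nx ^ j)) ℂ :=
  ∑ l ∈ (Finset.range j).attach,
    mcast (size1 (Finset.mem_range.mp l.2)) (size1 (Finset.mem_range.mp l.2))
      (kron (kronPow (1 : Matrix (Fin nx) (Fin nx) ℂ) ↑l)
        (kron F1 (kronPow (1 : Matrix (Fin nx) (Fin nx) ℂ) (j - ↑l - 1))))

/-- A_{j+1}^j = Σ_{l=0}^{j−1} I_{n_x}^{⊗l} ⊗ F2 ⊗ I_{n_x}^{⊗(j−l−1)}. -/
def Ajp1 (nx : ℕ) (F2 : Matrix (Fin nx) (Fin (nx ^ 2)) ℂ) (j : ℕ) :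
    Matrix (Fin (nx ^ j)) (Fin (nx ^ (j + 1))) ℂ :=
  ∑ l ∈ (Finset.range j).attach,
    mcast (size1 (Finset.mem_range.mp l.2)) (size2 (Finset.mem_range.mp l.2))
      (kron (kronPow (1 : Matrix (Fin nx) (Fin nx) ℂ) ↑l)
        (kron F2 (kronPow (1 : Matrix (Fin nx) (Fin nx) ℂ) (j - ↑l - 1))))

/-- The Carleman matrix A acting blockwise on y = (y_1,…,y_α), y_j ∈ ℂ^{n_x^j}:
(A y)_j = A_j^j y_j + A_{j+1}^j y_{j+1} for j ≤ α−1 and (A y)_α = A_α^α y_α. -/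
def carlA (nx α : ℕ) (F1 : Matrix (Fin nx) (Fin nx) ℂ) (F2 : Matrix (Fin nx) (Fin (nx ^ 2)) ℂ)
    (y : (k : Fin α) → Fin (nx ^ ((k : ℕ) + 1)) → ℂ) :
    (k : Fin α) → Fin (nx ^ ((k : ℕ) + 1)) → ℂ :=
  fun k =>
    (Ajj nx F1 ((k : ℕ) + 1)).mulVec (y k) +
      if h : (k : ℕ) + 1 < α then (Ajp1 nx F2 ((k : ℕ) + 1)).mulVec (y ⟨(k : ℕ) + 1, h⟩)
      else 0

/-- The embedded Carleman matrix A^{(e)} acting blockwise on (ℂ^{n_x^α})^α, whose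
blocks are the zero-paddings A_j^{(e),j}, A_{j+1}^{(e),j} of A_j^j and A_{j+1}^j. -/
def carlAe (nx α : ℕ) (F1 : Matrix (Fin nx) (Fin nx) ℂ) (F2 : Matrix (Fin nx) (Fin (nx ^ 2)) ℂ)
    (w : Fin α → Fin (nx ^ α) → ℂ) : Fin α → Fin (nx ^ α) → ℂ :=
  fun k =>
    (pad2 (nx ^ α) (nx ^ α) (Ajj nx F1 ((k : ℕ) + 1))).mulVec (w k) +
      if h : (k : ℕ) + 1 < α then
        (pad2 (nx ^ α) (nx ^ α) (Ajp1 nx F2 ((k : ℕ) + 1))).mulVec (w ⟨(k : ℕ) + 1, h⟩)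
      else 0

/-- The padding map ι : ℂ^Δ → (ℂ^{n_x^α})^α, extending each block y_j by zeros. -/
def iota (nx α : ℕ) (y : (k : Fin α) → Fin (nx ^ ((k : ℕ) + 1)) → ℂ) :
    Fin α → Fin (nx ^ α) → ℂ :=
  fun k i => if h : (i : ℕ) < nx ^ ((k : ℕ) + 1) then y k ⟨i, h⟩ else 0

/-- Kronecker product of vectors, with the big-endian identification
`(x ⊗ y)_{b·i+j} = x_i · y_j`. -/
def vkron {a b : ℕ} (x : Fin a → ℂ) (y : Fin b → ℂ) : Fin (a * b) → ℂ :=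
  fun i => x i.divNat * y i.modNat

/-- `j`-fold Kronecker power `u^{⊗j}` of a vector. -/
def vkronPow {n : ℕ} (u : Fin n → ℂ) : (j : ℕ) → Fin (n ^ j) → ℂ
  | 0 => fun _ => 1
  | j + 1 => vkron (vkronPow u j) u

/-- Recast a vector along an equality of its dimension. -/
def vcast {a b : ℕ} (h : a = b) (v : Fin a → ℂ) : Fin b → ℂ :=
  fun i => v (Fin.cast h.symm i)

theorem vcast_vcast {a b c : ℕ} (h : a = b) (h' : b = c) (x : Fin a → ℂ) :
    vcast h' (vcast h x) = vcast (h.trans h') x := rfl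

theorem vcast_add {a b : ℕ} (h : a = b) (x y : Fin a → ℂ) :
    vcast h (x + y) = vcast h x + vcast h y := rfl

theorem vkron_vcast_left {a b c : ℕ} (h : a = b) (x : Fin a → ℂ) (y : Fin c → ℂ) :
    vkron (vcast h x) y = vcast (by rw [h]) (vkron x y) := by
  subst h; rfl

theorem vkron_vcast_right {a b c : ℕ} (h : a = b) (x : Fin c → ℂ) (y : Fin a → ℂ) :
    vkron x (vcast h y) = vcast (by rw [h]) (vkron x y) := by
  subst h; rfl

theorem vkron_add_left {a b : ℕ} (x x' : Fin a → ℂ) (y : Fin b → ℂ) :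
    vkron (x + x') y = vkron x y + vkron x' y := by
  ext i; simp [vkron, add_mul]

theorem vkron_add_right {a b : ℕ} (x : Fin a → ℂ) (y y' : Fin b → ℂ) :
    vkron x (y + y') = vkron x y + vkron x y' := by
  ext i; simp [vkron, mul_add]

theorem vkron_assoc {a b c : ℕ} (x : Fin a → ℂ) (y : Fin b → ℂ) (z : Fin c → ℂ) :
    vkron x (vkron y z) = vcast (mul_assoc a b c) (vkron (vkron x y) z) := by
  ext i
  have h1 : (Fin.cast (mul_assoc a b c).symm i).divNat.divNat = i.divNat := by
    ext; simp [Nat.div_div_eq_div_mul, mul_comm]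
  have h2 : (Fin.cast (mul_assoc a b c).symm i).divNat.modNat = i.modNat.divNat := by
    ext; simp [mul_comm b c, Nat.mod_mul_right_div_self]
  have h3 : (Fin.cast (mul_assoc a b c).symm i).modNat = i.modNat.modNat := by
    ext; simp
  simp only [vkron, vcast, h1, h2, h3, mul_assoc]

theorem vkron_one_right {a : ℕ} (x : Fin a → ℂ) :
    vkron x (fun _ : Fin 1 => 1) = vcast (mul_one a).symm x := by
  ext i
  have h : i.divNat = Fin.cast (mul_one a) i := by ext; simp
  simp only [vkron, vcast, h, mul_one]

theorem vkron_one_left {a : ℕ} (x : Fin a → ℂ) :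
    vkron (fun _ : Fin 1 => 1) x = vcast (one_mul a).symm x := by
  ext i
  have h : i.modNat = Fin.cast (one_mul a) i := by
    ext
    have hi : (i : ℕ) < a := i.isLt.trans_eq (one_mul a)
    simp [Nat.mod_eq_of_lt hi]
  simp only [vkron, vcast, h, one_mul]

theorem vkronPow_succ {n : ℕ} (u : Fin n → ℂ) (j : ℕ) :
    vkronPow u (j + 1) = vkron (vkronPow u j) u := rfl

theorem vkronPow_one {n : ℕ} (u : Fin n → ℂ) : vkronPow u 1 = vcast (pow_one n).symm u :=
  vkron_one_left u

theorem vkronPow_two {n : ℕ} (u : Fin n → ℂ) :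
    vkronPow u 2 = vcast (sq n).symm (vkron u u) := by
  rw [vkronPow_succ, vkronPow_one, vkron_vcast_left]; rfl

theorem vkron_vkronPow {n : ℕ} (u : Fin n → ℂ) (l m : ℕ) :
    vkron (vkronPow u l) (vkronPow u m) = vcast (pow_add n l m) (vkronPow u (l + m)) := by
  induction m with
  | zero => exact vkron_one_right _
  | succ m ih =>
    change vkron (vkronPow u l) (vkron (vkronPow u m) u) =
      vcast _ (vkron (vkronPow u (l + m)) u)
    rw [vkron_assoc, ih, vkron_vcast_left]; rfl

theorem vcast_vkronPow {n c i j : ℕ} (u : Fin n → ℂ) (hij : i = j) (h : n ^ i = c)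
    (h' : n ^ j = c) : vcast h (vkronPow u i) = vcast h' (vkronPow u j) := by
  subst hij; rfl

/-- The power `u^{⊗j}` splits at any position `l`, with a block of size `p` in the middle. -/
theorem vcast_vkronPow_split {n p l k j : ℕ} (u : Fin n → ℂ) (hj : l + (p + k) = j)
    (h : n ^ j = n ^ l * (n ^ p * n ^ k)) :
    vcast h (vkronPow u j) = vkron (vkronPow u l) (vkron (vkronPow u p) (vkronPow u k)) := by
  rw [vkron_vkronPow, vkron_vcast_right, vkron_vkronPow, vcast_vcast]
  exact vcast_vkronPow u hj.symm _ _

theorem kron_mulVec_vkron {m n p q : ℕ} (A : Matrix (Fin m) (Fin n) ℂ)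
    (B : Matrix (Fin p) (Fin q) ℂ) (x : Fin n → ℂ) (y : Fin q → ℂ) :
    (kron A B).mulVec (vkron x y) = vkron (A.mulVec x) (B.mulVec y) := by
  ext i
  simp only [Matrix.mulVec, dotProduct, vkron, kron, Matrix.of_apply]
  rw [Finset.sum_mul_sum, ← Finset.sum_product', Finset.univ_product_univ,
    ← finProdFinEquiv.symm.sum_comp]
  refine Finset.sum_congr rfl fun k _ => ?_
  simp only [finProdFinEquiv_symm_apply]
  ring

theorem kron_one_one (m n : ℕ) :
    kron (1 : Matrix (Fin m) (Fin m) ℂ) (1 : Matrix (Fin n) (Fin n) ℂ) = 1 := by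
  ext i j
  have hij : i = j ↔ i.divNat = j.divNat ∧ i.modNat = j.modNat := by
    rw [← finProdFinEquiv.symm.injective.eq_iff]
    simp only [finProdFinEquiv_symm_apply, Prod.mk.injEq]
  by_cases h1 : i.divNat = j.divNat <;> by_cases h2 : i.modNat = j.modNat <;>
    simp [kron, Matrix.one_apply, hij, h1, h2]

theorem kronPow_one_eq_one {n : ℕ} (l : ℕ) : kronPow (1 : Matrix (Fin n) (Fin n) ℂ) l = 1 := by
  induction l with
  | zero => rfl
  | succ l ih => rw [kronPow, ih]; exact kron_one_one (n ^ l) n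

theorem mcast_mulVec {a b c d : ℕ} (h1 : a = b) (h2 : c = d) (M : Matrix (Fin a) (Fin c) ℂ)
    (x : Fin d → ℂ) : (mcast h1 h2 M).mulVec x = vcast h1 (M.mulVec (vcast h2.symm x)) := by
  subst h1 h2; rfl

/-- `u^{⊗j}` with the factor at position `l` replaced by `v` (and `u^{⊗j}` itself if `j ≤ l`). -/
def vkronSlot {n : ℕ} (u v : Fin n → ℂ) (l : ℕ) : (j : ℕ) → Fin (n ^ j) → ℂ
  | 0 => fun _ => 1
  | j + 1 => vkron (vkronSlot u v l j) (if j = l then v else u)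

theorem vkronSlot_of_le {n : ℕ} (u v : Fin n → ℂ) {l j : ℕ} (h : j ≤ l) :
    vkronSlot u v l j = vkronPow u j := by
  induction j with
  | zero => rfl
  | succ j ih => rw [vkronSlot, ih (by omega), if_neg (by omega)]; rfl

theorem vkronSlot_split {n : ℕ} (u v : Fin n → ℂ) (l k : ℕ)
    (h : n ^ l * (n * n ^ k) = n ^ (l + 1 + k)) :
    vkronSlot u v l (l + 1 + k) = vcast h (vkron (vkronPow u l) (vkron v (vkronPow u k))) := by
  induction k with
  | zero =>
    change vkron (vkronSlot u v l l) (if l = l then v else u) = _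
    have hv : vkron v (vkronPow u 0) = vcast (b := n * n ^ 0) (by simp) v := vkron_one_right v
    rw [vkronSlot_of_le u v le_rfl, if_pos rfl, hv, vkron_vcast_right]
    rfl
  | succ k ih =>
    change vkron (vkronSlot u v l (l + 1 + k)) (if l + 1 + k = l then v else u) = _
    have hv : vkron v (vkronPow u (k + 1)) =
        vcast (b := n * n ^ (k + 1)) (by rw [pow_succ, mul_assoc])
          (vkron (vkron v (vkronPow u k)) u) :=
      vkron_assoc v _ u
    rw [ih (by ring), if_neg (by omega), vkron_vcast_left, hv, vkron_vcast_right,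
      vkron_assoc (vkronPow u l) _ u]
    rfl

theorem vkronSlot_eq {n : ℕ} (u v : Fin n → ℂ) {l j : ℕ} (hl : l < j) :
    vkronSlot u v l j =
      vcast (size1 hl) (vkron (vkronPow u l) (vkron v (vkronPow u (j - l - 1)))) := by
  obtain ⟨k, rfl⟩ : ∃ k, j = l + 1 + k := ⟨j - l - 1, by omega⟩
  have key : ∀ m, m = k → ∀ h, vkronSlot u v l (l + 1 + k) =
      vcast h (vkron (vkronPow u l) (vkron v (vkronPow u m))) := by
    rintro m rfl h
    exact vkronSlot_split u v l m h
  exact key _ (by omega) _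

theorem vkronSlot_add_right {n : ℕ} (u v w : Fin n → ℂ) {l j : ℕ} (hl : l < j) :
    vkronSlot u (v + w) l j = vkronSlot u v l j + vkronSlot u w l j := by
  simp only [vkronSlot_eq _ _ hl, vkron_add_left, vkron_add_right, vcast_add]

theorem Ajj_mulVec_vkronPow {n : ℕ} (F : Matrix (Fin n) (Fin n) ℂ) (u : Fin n → ℂ) (j : ℕ) :
    (Ajj n F j).mulVec (vkronPow u j) = ∑ l ∈ range j, vkronSlot u (F.mulVec u) l j := by
  rw [← Finset.sum_attach, Ajj, Matrix.sum_mulVec]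
  refine Finset.sum_congr rfl fun ⟨l, hl⟩ _ => ?_
  have hl' := Finset.mem_range.mp hl
  have hu : vcast (size1 hl').symm (vkronPow u j) =
      vkron (vkronPow u l) (vkron u (vkronPow u (j - l - 1))) := by
    have := vcast_vkronPow_split (p := 1) (l := l) (k := j - l - 1) u
      (show _ = j by omega) (by rw [pow_one, size1 hl'])
    rw [vkronPow_one, vkron_vcast_left, vkron_vcast_right] at this
    exact congrArg (vcast (by rw [pow_one])) this
  rw [mcast_mulVec, vkronSlot_eq _ _ hl', hu]
  simp only [kron_mulVec_vkron, kronPow_one_eq_one, Matrix.one_mulVec]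

theorem Ajp1_mulVec_vkronPow {n : ℕ} (F : Matrix (Fin n) (Fin (n ^ 2)) ℂ) (u : Fin n → ℂ)
    (j : ℕ) : (Ajp1 n F j).mulVec (vkronPow u (j + 1)) =
      ∑ l ∈ range j, vkronSlot u (F.mulVec (vkronPow u 2)) l j := by
  rw [← Finset.sum_attach, Ajp1, Matrix.sum_mulVec]
  refine Finset.sum_congr rfl fun ⟨l, hl⟩ _ => ?_
  have hl' := Finset.mem_range.mp hl
  rw [mcast_mulVec, vkronSlot_eq _ _ hl',
    vcast_vkronPow_split (p := 2) (l := l) (k := j - l - 1) u (by omega)]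
  simp only [kron_mulVec_vkron, kronPow_one_eq_one, Matrix.one_mulVec]

/-- Leibniz rule for Kronecker powers. -/
theorem hasDerivAt_vkronPow {n : ℕ} {u : ℝ → Fin n → ℂ} {v : Fin n → ℂ} {t : ℝ}
    (hu : ∀ i, HasDerivAt (fun s => u s i) (v i) t) (j : ℕ) (i : Fin (n ^ j)) :
    HasDerivAt (fun s => vkronPow (u s) j i) ((∑ l ∈ range j, vkronSlot (u t) v l j) i) t := by
  induction j with
  | zero => exact hasDerivAt_const t (1 : ℂ)
  | succ j ih =>
    refine ((ih (Fin.divNat i)).mul (hu (Fin.modNat i))).congr_deriv ?_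
    symm
    rw [Finset.sum_range_succ, Pi.add_apply, Finset.sum_apply, Finset.sum_apply, Finset.sum_mul]
    congr 1
    · refine Finset.sum_congr rfl fun l hl => ?_
      rw [vkronSlot, if_neg (Finset.mem_range.mp hl).ne']; rfl
    · rw [vkronSlot, if_pos rfl, vkronSlot_of_le _ _ le_rfl]; rfl

/-- If u′(t) = F1·u(t) + F2·(u(t) ⊗ u(t)) componentwise, then for
every j ≥ 1 the Kronecker power u(t)^{⊗j} is differentiable with
d/dt [u^{⊗j}] = (Σ_l I^{⊗l} ⊗ F1 ⊗ I^{⊗(j−l−1)}) u^{⊗j}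
             + (Σ_l I^{⊗l} ⊗ F2 ⊗ I^{⊗(j−l−1)}) u^{⊗(j+1)}. -/
theorem statement19 (nx : ℕ) (hnx : 1 ≤ nx)
    (F1 : Matrix (Fin nx) (Fin nx) ℂ) (F2 : Matrix (Fin nx) (Fin (nx ^ 2)) ℂ)
    (u : ℝ → Fin nx → ℂ)
    (hu : ∀ (t : ℝ) (i : Fin nx),
      HasDerivAt (fun t' => u t' i)
        ((F1.mulVec (u t) + F2.mulVec (vcast (by ring) (vkron (u t) (u t)))) i) t) :
    ∀ j : ℕ, 1 ≤ j → ∀ (t : ℝ) (i : Fin (nx ^ j)),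
      HasDerivAt (fun t' => vkronPow (u t') j i)
        (((Ajj nx F1 j).mulVec (vkronPow (u t) j) +
            (Ajp1 nx F2 j).mulVec (vkronPow (u t) (j + 1))) i) t := by
  intro j _ t i
  rw [Ajj_mulVec_vkronPow, Ajp1_mulVec_vkronPow, ← Finset.sum_add_distrib]
  refine (hasDerivAt_vkronPow (hu t) j i).congr_deriv (congrFun ?_ i)
  refine Finset.sum_congr rfl fun l hl => ?_
  rw [vkronPow_two, ← vkronSlot_add_right _ _ _ (Finset.mem_range.mp hl)]
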